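/- The bialgebra W is not a Hopf algebra: there exists no k-linear map S : W → W satisfying ∇⧢ ∘ (S ⊗ id) ∘ Δ⊙ = ι ∘ ε = ∇⧢ ∘ (id ⊗ S) ∘ Δ⊙ (i.e., the identity map of W has no convolution inverse). -/

import Mathlib

abbrev Word : Type := List ℕ+

def maxLetter (w : Word) : ℕ := w.foldr (fun a n => max (a : ℕ) n) 0

open Classical in
noncomputable def wRestrict (w : Word) (S : Set ℕ+) : Word :=
  w.filter fun a => decide (a ∈ S)

def wUp (m : ℕ) (w : Word) : Word :=
  w.map fun (a : ℕ+) => ⟨(a : ℕ) + m, Nat.add_pos_left a.pos m⟩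

open scoped TensorProduct

/-- The basis set `𝕎`: pairs `[w,n]` with `max(w) ≤ n`. -/
def WIdx : Type := {p : Word × ℕ // ∀ a ∈ p.1, (a : ℕ) ≤ p.2}

/-- `W`: the free `k`-vector space on `𝕎`. -/
abbrev WSpace (k : Type*) [Field k] : Type _ := WIdx →₀ k

variable (k : Type*) [Field k]

/-- `u` is a shuffle of `v` and `w ↑ m`:
`u ∩ {1,…,m} = v`, `u ∩ {m+1,…,m+n} = w ↑ m` and `ℓ(u) = ℓ(v) + ℓ(w)`. -/
def IsShuffle (m n : ℕ) (v w u : Word) : Prop :=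
  wRestrict u {a : ℕ+ | (a : ℕ) ≤ m} = v ∧
  wRestrict u {a : ℕ+ | m < (a : ℕ) ∧ (a : ℕ) ≤ m + n} = wUp m w ∧
  u.length = v.length + w.length

/-- `∇⧢([v,m] ⊗ [w,n]) = Σ_u [u, m+n]` over all shuffles `u` of `v` and `w ↑ m`. -/
noncomputable def shufProd (p q : WIdx) : WSpace k :=
  ∑ᶠ (u : WIdx) (_ : u.1.2 = p.1.2 + q.1.2 ∧ IsShuffle p.1.2 q.1.2 p.1.1 q.1.1 u.1.1),
    Finsupp.single u 1

/-- The shifted shuffle product `∇⧢` as a bilinear map. -/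
noncomputable def mulW : WSpace k →ₗ[k] WSpace k →ₗ[k] WSpace k :=
  Finsupp.lift (WSpace k →ₗ[k] WSpace k) k WIdx fun p =>
    Finsupp.lift (WSpace k) k WIdx fun q => shufProd k p q

/-- `Δ⊙([w,n]) = Σ_i [w₁⋯wᵢ, n] ⊗ [wᵢ₊₁⋯, n]`, on a basis element. -/
noncomputable def deconc (p : WIdx) : WSpace k ⊗[k] WSpace k :=
  ∑ i ∈ Finset.range (p.1.1.length + 1),
    (Finsupp.single (⟨(p.1.1.take i, p.1.2),
        fun a ha => p.2 a (List.take_subset i p.1.1 ha)⟩ : WIdx) (1 : k)) ⊗ₜ[k]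
    (Finsupp.single (⟨(p.1.1.drop i, p.1.2),
        fun a ha => p.2 a (List.drop_subset i p.1.1 ha)⟩ : WIdx) (1 : k))

/-- The deconcatenation coproduct `Δ⊙`. -/
noncomputable def comulW : WSpace k →ₗ[k] WSpace k ⊗[k] WSpace k :=
  Finsupp.lift (WSpace k ⊗[k] WSpace k) k WIdx (deconc k)

/-- The unit element `[∅, 0]`. -/
noncomputable def unitW : WSpace k :=
  Finsupp.single ⟨(([] : Word), 0), by intro a ha; simp at ha⟩ 1

/-- The counit `ε`. -/
noncomputable def counitW : WSpace k →ₗ[k] k :=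
  Finsupp.lift k k WIdx fun p => if p.1.1 = [] then 1 else 0

/-- The degree-`d` homogeneous component of `W` (spanned by basis elements
`[w,n]` with `ℓ(w) = d`). -/
noncomputable def Wdeg (d : ℕ) : Submodule k (WSpace k) :=
  Submodule.span k {f : WSpace k | ∃ p : WIdx, p.1.1.length = d ∧ f = Finsupp.single p 1}

/-- The basis element `[∅, n]`. -/
def emptyIdx (n : ℕ) : WIdx := ⟨([], n), fun a ha => by simp at ha⟩

lemma shufProd_apply_eq_zero (p q r : WIdx) (h : r.1.2 ≠ p.1.2 + q.1.2) :
    shufProd k p q r = 0 := by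
  unfold shufProd
  refine finsum_induction (fun f : WSpace k => f r = 0) rfl
    (fun f g hf hg => by simp [hf, hg]) fun u => ?_
  refine finsum_induction (fun f : WSpace k => f r = 0) rfl
    (fun f g hf hg => by simp [hf, hg]) fun hu => ?_
  refine Finsupp.single_eq_of_ne ?_
  rintro rfl
  exact h hu.1

lemma mulW_single_apply_eq_zero (x : WSpace k) (q r : WIdx) (h : r.1.2 < q.1.2) :
    mulW k x (Finsupp.single q 1) r = 0 := by
  induction x using Finsupp.induction_linear with
  | zero => simp
  | add f g hf hg => simp [hf, hg]
  | single p c =>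
    simp [mulW, shufProd_apply_eq_zero k p q r (by omega)]

lemma comulW_single_emptyIdx (n : ℕ) :
    comulW k (Finsupp.single (emptyIdx n) 1) =
      Finsupp.single (emptyIdx n) 1 ⊗ₜ[k] Finsupp.single (emptyIdx n) 1 := by
  have h : comulW k (Finsupp.single (emptyIdx n) 1) = deconc k (emptyIdx n) := by
    simp [comulW]
  rw [h]
  simp [deconc, emptyIdx]

lemma counitW_single_emptyIdx (n : ℕ) :
    counitW k (Finsupp.single (emptyIdx n) 1) = 1 := by
  simp only [counitW, Finsupp.lift_apply, zero_smul, Finsupp.sum_single_index]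
  simp [emptyIdx]

theorem stmt5 :
    -- the identity of `W` has no convolution inverse: `W` is not a Hopf algebra
    ¬ ∃ S : WSpace k →ₗ[k] WSpace k,
        TensorProduct.lift (mulW k) ∘ₗ TensorProduct.map S LinearMap.id ∘ₗ comulW k =
            LinearMap.toSpanSingleton k (WSpace k) (unitW k) ∘ₗ counitW k ∧
          TensorProduct.lift (mulW k) ∘ₗ TensorProduct.map LinearMap.id S ∘ₗ comulW k =
            LinearMap.toSpanSingleton k (WSpace k) (unitW k) ∘ₗ counitW k := by
  rintro ⟨S, hS, -⟩
  have h := DFunLike.congr_fun (LinearMap.congr_fun hS (Finsupp.single (emptyIdx 1) 1)) (emptyIdx 0)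
  have hunit : unitW k = Finsupp.single (emptyIdx 0) 1 := rfl
  simp only [LinearMap.comp_apply, comulW_single_emptyIdx, TensorProduct.map_tmul,
    TensorProduct.lift.tmul, LinearMap.id_apply, counitW_single_emptyIdx,
    LinearMap.toSpanSingleton_apply, one_smul, hunit, Finsupp.single_eq_same] at h
  rw [mulW_single_apply_eq_zero k _ _ _ (by simp [emptyIdx])] at h
  exact zero_ne_one h
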